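/- arXiv:2506.00838 — 5 statements merged into one kernel-verified Lean document; each statement's English description precedes it below -/
import Mathlib

section
/- Let K ⊆ ℝⁿ be a measurable set and let p, q : ℝⁿ → ℝ be two probability densities supported on K (nonnegative, vanishing outside K, integrating to 1 over K with respect to Lebesgue measure) such that p·ln p and q·ln q are Lebesgue-integrable over K and p and q are not almost-everywhere equal on K. Then the entropy functional H(f) = -∫_K f(x) ln f(x) dx satisfies the strict midpoint-concavity inequality H((p+q)/2) > (H(p) + H(q))/2. -/
open MeasureTheory Real

theorem mul_log_add_mul_log_le {a b : ℝ} (ha : 0 ≤ a) (hb : 0 ≤ b) :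
    a * Real.log a + b * Real.log b ≤ (a + b) * Real.log (a + b) := by
  rcases ha.eq_or_lt with rfl | ha
  · simp
  rcases hb.eq_or_lt with rfl | hb
  · simp
  have h₁ := mul_le_mul_of_nonneg_left (Real.log_le_log ha (by linarith : a ≤ a + b)) ha.le
  have h₂ := mul_le_mul_of_nonneg_left (Real.log_le_log hb (by linarith : b ≤ a + b)) hb.le
  linarith

theorem half_mul_log_half (a : ℝ) :
    a / 2 * Real.log (a / 2) = a * Real.log a / 2 - a * Real.log 2 / 2 := by
  rcases eq_or_ne a 0 with rfl | ha
  · simp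
  rw [Real.log_div ha two_ne_zero]
  ring

theorem midpoint_mul_log_lt {a b : ℝ} (ha : 0 ≤ a) (hb : 0 ≤ b) (hab : a ≠ b) :
    (a + b) / 2 * Real.log ((a + b) / 2) < (a * Real.log a + b * Real.log b) / 2 := by
  have h := Real.strictConvexOn_mul_log.2 (Set.mem_Ici.2 ha) (Set.mem_Ici.2 hb) hab
    (by norm_num : (0 : ℝ) < 1 / 2) (by norm_num : (0 : ℝ) < 1 / 2) (by norm_num)
  simp only [smul_eq_mul] at h
  rw [show 1 / 2 * a + 1 / 2 * b = (a + b) / 2 by ring] at h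
  linarith

theorem midpoint_mul_log_le {a b : ℝ} (ha : 0 ≤ a) (hb : 0 ≤ b) :
    (a + b) / 2 * Real.log ((a + b) / 2) ≤ (a * Real.log a + b * Real.log b) / 2 := by
  rcases eq_or_ne a b with rfl | hab
  · simp
  · exact (midpoint_mul_log_lt ha hb hab).le

theorem integrable_midpoint_mul_log {α : Type*} [MeasurableSpace α] {μ : Measure α}
    {p q : α → ℝ} (hp₀ : ∀ x, 0 ≤ p x) (hq₀ : ∀ x, 0 ≤ q x)
    (hp : Integrable p μ) (hq : Integrable q μ)
    (hpl : Integrable (fun x => p x * Real.log (p x)) μ)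
    (hql : Integrable (fun x => q x * Real.log (q x)) μ) :
    Integrable (fun x => (p x + q x) / 2 * Real.log ((p x + q x) / 2)) μ := by
  have hu : Integrable (fun x => (p x * Real.log (p x) + q x * Real.log (q x)) / 2) μ :=
    (hpl.add hql).div_const 2
  have hl : Integrable (fun x => (p x * Real.log (p x) + q x * Real.log (q x)) / 2
      - (p x + q x) * Real.log 2 / 2) μ :=
    hu.sub (((hp.add hq).mul_const _).div_const 2)
  refine integrable_of_le_of_le
    (Real.continuous_mul_log.comp_aestronglyMeasurable
      ((hp.add hq).div_const 2).aestronglyMeasurable)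
    (.of_forall fun x => ?_) (.of_forall fun x => midpoint_mul_log_le (hp₀ x) (hq₀ x)) hl hu
  have h := mul_log_add_mul_log_le (div_nonneg (hp₀ x) zero_le_two) (div_nonneg (hq₀ x) zero_le_two)
  rw [half_mul_log_half, half_mul_log_half, ← add_div] at h
  dsimp only [Function.comp_apply]
  linarith

/-- **Strict midpoint-concavity of the entropy functional.**
If `p` and `q` are probability densities supported on a measurable set `K ⊆ ℝⁿ`,
with integrable entropy integrands, and `p` and `q` are not a.e. equal on `K`,
then the entropy `H(f) = -∫_K f ln f` satisfies
`H((p+q)/2) > (H(p) + H(q))/2`. -/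
theorem entropy_strict_midpoint_concave {n : ℕ} (K : Set (Fin n → ℝ))
    (hK : MeasurableSet K) (p q : (Fin n → ℝ) → ℝ)
    (hpMeas : Measurable p) (hqMeas : Measurable q)
    (hpNonneg : ∀ x, 0 ≤ p x) (hqNonneg : ∀ x, 0 ≤ q x)
    (hpSupp : ∀ x ∉ K, p x = 0) (hqSupp : ∀ x ∉ K, q x = 0)
    (hpInt : ∫ x in K, p x = 1) (hqInt : ∫ x in K, q x = 1)
    (hpEnt : IntegrableOn (fun x => p x * Real.log (p x)) K volume)
    (hqEnt : IntegrableOn (fun x => q x * Real.log (q x)) K volume)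
    (hne : ¬ (p =ᵐ[volume.restrict K] q)) :
    (-∫ x in K, ((p x + q x) / 2) * Real.log ((p x + q x) / 2)) >
      ((-∫ x in K, p x * Real.log (p x)) + (-∫ x in K, q x * Real.log (q x))) / 2 := by
  have hp : Integrable p (volume.restrict K) := integrable_of_integral_eq_one hpInt
  have hq : Integrable q (volume.restrict K) := integrable_of_integral_eq_one hqInt
  have hm := integrable_midpoint_mul_log hpNonneg hqNonneg hp hq hpEnt hqEnt
  have hs : Integrable (fun x => (p x * Real.log (p x) + q x * Real.log (q x)) / 2)
      (volume.restrict K) := (hpEnt.add hqEnt).div_const 2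
  have hle : ∀ x, (p x + q x) / 2 * Real.log ((p x + q x) / 2) ≤
      (p x * Real.log (p x) + q x * Real.log (q x)) / 2 :=
    fun x => midpoint_mul_log_le (hpNonneg x) (hqNonneg x)
  have hs_eq : ∫ x in K, (p x * Real.log (p x) + q x * Real.log (q x)) / 2 =
      ((∫ x in K, p x * Real.log (p x)) + ∫ x in K, q x * Real.log (q x)) / 2 := by
    rw [integral_div, integral_add hpEnt hqEnt]
  have hlt : ∫ x in K, (p x + q x) / 2 * Real.log ((p x + q x) / 2) <
      ∫ x in K, (p x * Real.log (p x) + q x * Real.log (q x)) / 2 := by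
    refine lt_of_le_of_ne (integral_mono hm hs hle) fun heq => hne ?_
    filter_upwards [(integral_eq_iff_of_ae_le hm hs (.of_forall hle)).1 heq] with x hx
    by_contra hpq
    exact (midpoint_mul_log_lt (hpNonneg x) (hqNonneg x) hpq).ne hx
  linarith
end

section
/- Let K ⊆ ℝⁿ be a measurable set, let I be a finite set of multi-indices α ∈ ℕⁿ, and let q be a probability density on K such that q·ln q is integrable over K and every monomial x^α (α ∈ I) is integrable against q, with moments m_α = ∫_K x^α q(x) dx. Then for every λ : I → ℝ such that x ↦ exp(-∑_{α∈I} λ_α x^α) is Lebesgue-integrable over K with positive integral, the weak-duality bound -∫_K q(x) ln q(x) dx ≤ ln(∫_K exp(-∑_{α∈I} λ_α x^α) dx) + ∑_{α∈I} λ_α m_α holds. -/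
open MeasureTheory Real

/-- A pointwise form of the Gibbs inequality, comparing `t` with the normalized weight
`exp (-s) / Z`. -/
theorem neg_mul_log_le_gibbs {t s Z : ℝ} (ht : 0 ≤ t) (hZ : 0 < Z) :
    -(t * Real.log t) ≤ Real.log Z * t + s * t + (Real.exp (-s) / Z - t) := by
  rcases ht.eq_or_lt with rfl | ht
  · have : 0 ≤ Real.exp (-s) / Z := by positivity
    simpa using this
  · have hlog : Real.log (Real.exp (-s) / Z / t) = -s - Real.log Z - Real.log t := by
      rw [Real.log_div (by positivity) ht.ne', Real.log_div (by positivity) hZ.ne', Real.log_exp]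
    have hle := Real.log_le_sub_one_of_pos (x := Real.exp (-s) / Z / t) (by positivity)
    rw [hlog] at hle
    have hmul := mul_le_mul_of_nonneg_left hle ht.le
    have hcancel : t * (Real.exp (-s) / Z / t - 1) = Real.exp (-s) / Z - t := by
      field_simp
    rw [hcancel] at hmul
    linarith

/-- The Gibbs variational inequality: the entropy of a probability density `q` is at most the
logarithm of the partition function of a potential `S` plus the mean of `S` under `q`. -/
theorem neg_integral_mul_log_le_log_integral_exp_add {X : Type*} [MeasurableSpace X]
    {μ : Measure X} {q S : X → ℝ} (hq : ∀ x, 0 ≤ q x) (hq1 : (∫ x, q x ∂μ) = 1)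
    (hent : Integrable (fun x => q x * Real.log (q x)) μ)
    (hS : Integrable (fun x => S x * q x) μ)
    (hexp : Integrable (fun x => Real.exp (-S x)) μ)
    (hpos : 0 < ∫ x, Real.exp (-S x) ∂μ) :
    (-∫ x, q x * Real.log (q x) ∂μ) ≤
      Real.log (∫ x, Real.exp (-S x) ∂μ) + ∫ x, S x * q x ∂μ := by
  have hqi : Integrable q μ := integrable_of_integral_eq_one hq1
  set Z := ∫ x, Real.exp (-S x) ∂μ with hZ
  have hl : Integrable (fun x => Real.log Z * q x) μ := hqi.const_mul _
  have hls : Integrable (fun x => Real.log Z * q x + S x * q x) μ := hl.add hS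
  have he : Integrable (fun x => Real.exp (-S x) / Z) μ := hexp.div_const Z
  have heq : Integrable (fun x => Real.exp (-S x) / Z - q x) μ := he.sub hqi
  rw [← integral_neg]
  calc ∫ x, -(q x * Real.log (q x)) ∂μ
      ≤ ∫ x, (Real.log Z * q x + S x * q x + (Real.exp (-S x) / Z - q x)) ∂μ :=
        integral_mono hent.neg (hls.add heq) fun x => neg_mul_log_le_gibbs (hq x) hpos
    _ = Real.log Z + ∫ x, S x * q x ∂μ := by
        rw [integral_add hls heq, integral_add hl hS, integral_sub he hqi, integral_const_mul,
          integral_div, hq1, ← hZ, div_self hpos.ne']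
        ring

/-- **Weak duality for the moment-constrained maximum-entropy problem.**
For any probability density `q` on `K` with integrable entropy integrand and
integrable monomials `x^α` (`α ∈ I`), and any coefficient vector `λ` whose
exponential `exp(-∑_α λ_α x^α)` is integrable over `K` with positive integral, the
entropy of `q` is bounded by the normalized thermodynamic potential:
`H(q) ≤ ln(∫_K exp(-∑_α λ_α x^α) dx) + ∑_α λ_α m_α`. -/
theorem entropy_weak_duality {n : ℕ} (K : Set (Fin n → ℝ)) (hK : MeasurableSet K)
    (I : Finset (Fin n → ℕ)) (q : (Fin n → ℝ) → ℝ)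
    (hqMeas : Measurable q) (hqNonneg : ∀ x, 0 ≤ q x) (hqSupp : ∀ x ∉ K, q x = 0)
    (hqInt : (∫ x in K, q x) = 1)
    (hqEnt : IntegrableOn (fun x => q x * Real.log (q x)) K volume)
    (hqMom : ∀ α ∈ I, IntegrableOn (fun x => (∏ i, x i ^ α i) * q x) K volume)
    (m : (Fin n → ℕ) → ℝ)
    (hm : ∀ α ∈ I, (∫ x in K, (∏ i, x i ^ α i) * q x) = m α)
    (lam : (Fin n → ℕ) → ℝ)
    (hInt : IntegrableOn (fun x => Real.exp (-(∑ α ∈ I, lam α * ∏ i, x i ^ α i))) K volume)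
    (hPos : 0 < ∫ x in K, Real.exp (-(∑ α ∈ I, lam α * ∏ i, x i ^ α i))) :
    (-∫ x in K, q x * Real.log (q x)) ≤
      Real.log (∫ x in K, Real.exp (-(∑ α ∈ I, lam α * ∏ i, x i ^ α i)))
        + ∑ α ∈ I, lam α * m α := by
  have hmom : ∀ α ∈ I, Integrable (fun x => lam α * ((∏ i, x i ^ α i) * q x))
      (volume.restrict K) := fun α hα => (hqMom α hα).const_mul _
  have hsum : (fun x : Fin n → ℝ => (∑ α ∈ I, lam α * ∏ i, x i ^ α i) * q x) =
      fun x => ∑ α ∈ I, lam α * ((∏ i, x i ^ α i) * q x) := by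
    funext x
    simp only [Finset.sum_mul, mul_assoc]
  have hmean : (∫ x in K, (∑ α ∈ I, lam α * ∏ i, x i ^ α i) * q x) = ∑ α ∈ I, lam α * m α := by
    rw [hsum, integral_finsetSum I hmom]
    exact Finset.sum_congr rfl fun α hα => by rw [integral_const_mul, hm α hα]
  rw [← hmean]
  refine neg_integral_mul_log_le_log_integral_exp_add hqNonneg hqInt hqEnt ?_ hInt hPos
  rw [hsum]
  exact integrable_finsetSum I hmom
end

section
/- Let K ⊆ ℝⁿ be a measurable set, let I be a finite set of multi-indices α ∈ ℕⁿ, and let m : I → ℝ. Let λ* : I → ℝ be such that x ↦ exp(-∑_{α∈I} λ*_α x^α) and x ↦ exp(-∑_{α∈I} λ*_α x^α)·x^β (for every β ∈ I) are Lebesgue-integrable over K, and suppose the moment constraints ∫_K exp(-∑_{α∈I} λ*_α x^α) x^β dx = m_β hold for all β ∈ I. Then for every λ : I → ℝ for which x ↦ exp(-∑_{α∈I} λ_α x^α) is integrable over K, one has Δ(λ*) ≤ Δ(λ), where Δ(λ) = ∫_K exp(-∑_{α∈I} λ_α x^α) dx + ∑_{α∈I} λ_α m_α. That is, any coefficient vector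 whose exponential density matches the prescribed moments is a global minimizer of the thermodynamic potential. -/
open MeasureTheory Real

/-- A dual objective `∫ exp (-∑ λ_a f_a) + ∑ λ_a m_a` is minimized by any coefficient family
whose exponential density has the prescribed moments `m_a` against the functions `f_a`. -/
theorem integral_exp_neg_sum_add_le_of_moments_eq {X ι : Type*} [MeasurableSpace X]
    {μ : Measure X} (s : Finset ι) (f : ι → X → ℝ) (m c d : ι → ℝ)
    (hc : Integrable (fun x => Real.exp (-(∑ a ∈ s, c a * f a x))) μ)
    (hcf : ∀ b ∈ s, Integrable (fun x => Real.exp (-(∑ a ∈ s, c a * f a x)) * f b x) μ)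
    (hm : ∀ b ∈ s, (∫ x, Real.exp (-(∑ a ∈ s, c a * f a x)) * f b x ∂μ) = m b)
    (hd : Integrable (fun x => Real.exp (-(∑ a ∈ s, d a * f a x))) μ) :
    (∫ x, Real.exp (-(∑ a ∈ s, c a * f a x)) ∂μ) + ∑ a ∈ s, c a * m a ≤
      (∫ x, Real.exp (-(∑ a ∈ s, d a * f a x)) ∂μ) + ∑ a ∈ s, d a * m a := by
  have hterm : ∀ b ∈ s, Integrable
      (fun x => (c b - d b) * (Real.exp (-(∑ a ∈ s, c a * f a x)) * f b x)) μ :=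
    fun b hb => (hcf b hb).const_mul _
  have hsum := integrable_finsetSum s hterm
  have hle := integral_mono (hc.add hsum) hd fun x => by
    have hexp := Real.add_one_le_exp
      ((∑ a ∈ s, c a * f a x) - ∑ a ∈ s, d a * f a x)
    have hmul := mul_le_mul_of_nonneg_left hexp
      (Real.exp_pos (-(∑ a ∈ s, c a * f a x))).le
    rw [← Real.exp_add, neg_add_eq_sub, sub_sub_cancel_left] at hmul
    have hlin : ∑ b ∈ s, (c b - d b) * (Real.exp (-(∑ a ∈ s, c a * f a x)) * f b x) =
        Real.exp (-(∑ a ∈ s, c a * f a x)) *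
          ((∑ a ∈ s, c a * f a x) - ∑ a ∈ s, d a * f a x) := by
      rw [← Finset.sum_sub_distrib, Finset.mul_sum]
      exact Finset.sum_congr rfl fun b _ => by ring
    simp only [Pi.add_apply]
    rw [hlin]
    linarith
  have hint : (∫ x, ∑ b ∈ s,
      (c b - d b) * (Real.exp (-(∑ a ∈ s, c a * f a x)) * f b x) ∂μ) =
      ∑ a ∈ s, c a * m a - ∑ a ∈ s, d a * m a := by
    rw [integral_finsetSum s hterm, ← Finset.sum_sub_distrib]
    refine Finset.sum_congr rfl fun b hb => ?_
    rw [integral_const_mul, hm b hb, sub_mul]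
  rw [integral_add' hc hsum, hint] at hle
  linarith

/-- **Moment-matching coefficients globally minimize the thermodynamic potential.**
If the exponential density with coefficients `λ*` matches the prescribed moments
`m_β` for all `β ∈ I`, then `λ*` is a global minimizer of the thermodynamic
potential `Δ(λ) = ∫_K exp(-∑_{α∈I} λ_α x^α) dx + ∑_{α∈I} λ_α m_α` among all `λ`
for which the exponential is integrable over `K`. -/
theorem momentMatching_minimizes_thermoPotential {n : ℕ} (K : Set (Fin n → ℝ))
    (hK : MeasurableSet K) (I : Finset (Fin n → ℕ)) (m : (Fin n → ℕ) → ℝ)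
    (lamStar : (Fin n → ℕ) → ℝ)
    (hIntStar : IntegrableOn
      (fun x => Real.exp (-(∑ α ∈ I, lamStar α * ∏ i, x i ^ α i))) K volume)
    (hIntStarMom : ∀ β ∈ I, IntegrableOn
      (fun x => Real.exp (-(∑ α ∈ I, lamStar α * ∏ i, x i ^ α i))
        * ∏ i, x i ^ β i) K volume)
    (hMom : ∀ β ∈ I,
      (∫ x in K, Real.exp (-(∑ α ∈ I, lamStar α * ∏ i, x i ^ α i))
        * ∏ i, x i ^ β i) = m β) :
    ∀ lam : (Fin n → ℕ) → ℝ,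
      IntegrableOn (fun x => Real.exp (-(∑ α ∈ I, lam α * ∏ i, x i ^ α i))) K volume →
      (∫ x in K, Real.exp (-(∑ α ∈ I, lamStar α * ∏ i, x i ^ α i)))
          + ∑ α ∈ I, lamStar α * m α ≤
        (∫ x in K, Real.exp (-(∑ α ∈ I, lam α * ∏ i, x i ^ α i)))
          + ∑ α ∈ I, lam α * m α := by
  intro lam hlam
  exact integral_exp_neg_sum_add_le_of_moments_eq (μ := volume.restrict K) I
    (fun α x => ∏ i, x i ^ α i) m lamStar lam hIntStar hIntStarMom hMom hlam
end

section
/- Let K ⊆ ℝⁿ be a measurable set of positive Lebesgue measure, let I be a finite set of multi-indices α ∈ ℕⁿ, and let λ : I → ℝ be such that for all β, γ ∈ I the function x ↦ exp(-∑_{α∈I} λ_α x^α)·x^{β+γ} is Lebesgue-integrable over K. Then for every nonzero v : I → ℝ, the Hessian quadratic form is strictly positive: ∑_{β,γ∈I} v_β v_γ ∫_K exp(-∑_{α∈I} λ_α x^α) x^{β+γ} dx > 0. Consequently the Hessian of the thermodynamic potential is positive definite. -/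
open MeasureTheory Real

/-- The zero set of a nonzero real polynomial has Lebesgue measure zero. -/
theorem MvPolynomial.volume_setOf_eval_eq_zero {n : ℕ} (p : MvPolynomial (Fin n) ℝ) (hp : p ≠ 0) :
    volume {x : Fin n → ℝ | MvPolynomial.eval x p = 0} = 0 := by
  induction n with
  | zero =>
    obtain ⟨c, rfl⟩ := MvPolynomial.C_surjective (Fin 0) p
    have hc : c ≠ 0 := by
      rintro rfl
      simp at hp
    simp [hc]
  | succ n ih =>
    set q := MvPolynomial.finSuccEquiv ℝ n p with hq
    have hq0 : q ≠ 0 := by simpa [hq] using hp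
    have hlead := ih q.leadingCoeff (Polynomial.leadingCoeff_ne_zero.mpr hq0)
    have hmp := (volume_preserving_piFinSuccAbove (fun _ : Fin (n + 1) => ℝ) 0).symm
    have hs : MeasurableSet {x : Fin (n + 1) → ℝ | MvPolynomial.eval x p = 0} :=
      (isClosed_eq (MvPolynomial.continuous_eval p) continuous_const).measurableSet
    rw [← hmp.measure_preimage hs.nullMeasurableSet, Measure.volume_eq_prod,
      Measure.prod_apply_symm (hmp.measurable hs), lintegral_eq_zero_iff'
        (measurable_measure_prodMk_right (hmp.measurable hs)).aemeasurable]
    have hae : ∀ᵐ y : Fin n → ℝ, MvPolynomial.eval y q.leadingCoeff ≠ 0 := by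
      rw [ae_iff]
      simpa using hlead
    filter_upwards [hae] with y hy
    have hmap : q.map (MvPolynomial.eval y) ≠ 0 := by
      intro h
      apply hy
      have := congrArg (fun r => Polynomial.coeff r q.natDegree) h
      simpa using this
    refine ((Polynomial.finite_setOfPred_isRoot hmap).subset ?_).measure_zero _
    intro a ha
    have ha' : MvPolynomial.eval (Fin.cons a y : Fin (n + 1) → ℝ) p = 0 := by
      simpa [MeasurableEquiv.piFinSuccAbove, Fin.insertNthEquiv] using ha
    rw [MvPolynomial.eval_eq_eval_mv_eval'] at ha'
    exact ha'

/-- A nontrivial real linear combination of distinct monomials is nonzero almost everywhere. -/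
theorem ae_sum_mul_prod_pow_ne_zero {n : ℕ} (I : Finset (Fin n → ℕ)) {v : I → ℝ} (hv : v ≠ 0) :
    ∀ᵐ x : Fin n → ℝ, ∑ β : I, v β * ∏ i, x i ^ (β : Fin n → ℕ) i ≠ 0 := by
  set p : MvPolynomial (Fin n) ℝ :=
    ∑ β : I, MvPolynomial.monomial (Finsupp.equivFunOnFinite.symm (β : Fin n → ℕ)) (v β) with hp
  have hp0 : p ≠ 0 := by
    intro h
    apply hv
    funext γ
    have := congrArg (MvPolynomial.coeff (Finsupp.equivFunOnFinite.symm (γ : Fin n → ℕ))) h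
    simpa [hp, MvPolynomial.coeff_sum, MvPolynomial.coeff_monomial] using this
  have h := MvPolynomial.volume_setOf_eval_eq_zero p hp0
  rw [ae_iff]
  simpa [hp, MvPolynomial.eval_monomial, Finsupp.prod_fintype] using h

/-- **Positive definiteness of the Hessian of the thermodynamic potential.**
If `K ⊆ ℝⁿ` has positive Lebesgue measure, then for every nonzero `v : I → ℝ` the
Hessian quadratic form is strictly positive:
`∑_{β,γ∈I} v_β v_γ ∫_K exp(-∑_{α∈I} λ_α x^α) x^{β+γ} dx > 0`. -/
theorem thermoPotential_hessian_posDef {n : ℕ} (K : Set (Fin n → ℝ))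
    (hK : MeasurableSet K) (hKpos : 0 < volume K)
    (I : Finset (Fin n → ℕ)) (lam : I → ℝ)
    (hInt : ∀ β γ : I, IntegrableOn
      (fun x => Real.exp (-(∑ α : I, lam α * ∏ i, x i ^ (α : Fin n → ℕ) i))
        * ∏ i, x i ^ ((β : Fin n → ℕ) i + (γ : Fin n → ℕ) i)) K volume) :
    ∀ v : I → ℝ, v ≠ 0 →
      0 < ∑ β : I, ∑ γ : I, v β * v γ *
          ∫ x in K, Real.exp (-(∑ α : I, lam α * ∏ i, x i ^ (α : Fin n → ℕ) i))
            * ∏ i, x i ^ ((β : Fin n → ℕ) i + (γ : Fin n → ℕ) i) := by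
  intro v hv
  set w : (Fin n → ℝ) → ℝ :=
    fun x => Real.exp (-(∑ α : I, lam α * ∏ i, x i ^ (α : Fin n → ℕ) i))
  set q : (Fin n → ℝ) → ℝ := fun x => ∑ β : I, v β * ∏ i, x i ^ (β : Fin n → ℕ) i
  have hterm : ∀ β γ : I, IntegrableOn
      (fun x => v β * v γ * (w x * ∏ i, x i ^ ((β : Fin n → ℕ) i + (γ : Fin n → ℕ) i))) K :=
    fun β γ => (hInt β γ).const_mul _
  have hpt : ∀ x, ∑ β : I, ∑ γ : I,
      v β * v γ * (w x * ∏ i, x i ^ ((β : Fin n → ℕ) i + (γ : Fin n → ℕ) i)) = w x * q x ^ 2 := by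
    intro x
    simp only [q]
    rw [sq, Finset.sum_mul_sum]
    simp only [Finset.mul_sum, pow_add, Finset.prod_mul_distrib]
    refine Finset.sum_congr rfl fun β _ => Finset.sum_congr rfl fun γ _ => ?_
    ring
  have hsum : IntegrableOn (fun x => w x * q x ^ 2) K := by
    simp only [← hpt]
    exact integrable_finsetSum _ fun β _ => integrable_finsetSum _ fun γ _ => hterm β γ
  have heq : ∑ β : I, ∑ γ : I, v β * v γ *
      ∫ x in K, w x * ∏ i, x i ^ ((β : Fin n → ℕ) i + (γ : Fin n → ℕ) i)
      = ∫ x in K, w x * q x ^ 2 := by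
    simp only [← hpt]
    rw [integral_finsetSum _ fun β _ => integrable_finsetSum _ fun γ _ => hterm β γ]
    refine Finset.sum_congr rfl fun β _ => ?_
    rw [integral_finsetSum _ fun γ _ => hterm β γ]
    exact Finset.sum_congr rfl fun γ _ => (integral_const_mul _ _).symm
  have hnonneg : ∀ x, 0 ≤ w x * q x ^ 2 := fun x => by positivity
  rw [heq, integral_pos_iff_support_of_nonneg hnonneg hsum]
  have hsupp : Function.support (fun x => w x * q x ^ 2) =ᵐ[volume.restrict K] Set.univ := by
    filter_upwards [ae_restrict_of_ae (ae_sum_mul_prod_pow_ne_zero I hv)] with x hx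
    exact eq_true (mul_ne_zero (Real.exp_pos _).ne' (pow_ne_zero 2 hx))
  rwa [measure_congr hsupp, Measure.restrict_apply_univ]
end

section
/- Let K ⊆ ℝⁿ be a compact measurable set with positive Lebesgue measure, and let f be a probability density on K with f·ln f Lebesgue-integrable. For each r ∈ ℕ, let p_r be a probability density on K such that: (i) p_r·ln p_r is integrable; (ii) ∫_K x^α p_r(x) dx = ∫_K x^α f(x) dx for every multi-index α ∈ ℕⁿ with |α| ≤ r; and (iii) p_r maximizes the entropy H(q) = -∫_K q ln q dx among all probability densities q on K with q·ln q integrable satisfying the moment constraints in (ii). Then p_r converges to f in L¹-norm: lim_{r→∞} ∫_K |p_r(x) − f(x)| dx = 0. -/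
open MeasureTheory Real Filter

/-- `f` is a probability density on `K` (w.r.t. Lebesgue measure). -/
def IsDensityOn {n : ℕ} (K : Set (Fin n → ℝ)) (f : (Fin n → ℝ) → ℝ) : Prop :=
  Measurable f ∧ (∀ x, 0 ≤ f x) ∧ (∀ x ∉ K, f x = 0) ∧ (∫ x in K, f x) = 1

/-- The tangent-line inequality for `t * log t`, with a Hellinger-type remainder. -/
lemma sq_sqrt_sub_sqrt_le_mul_log_sub {a m : ℝ} (ha : 0 ≤ a) (hm : 0 < m) :
    a - m + (√a - √m) ^ 2 ≤ a * log a - a * log m := by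
  have hms := sq_sqrt hm.le
  rcases ha.eq_or_lt with rfl | ha
  · simp [hms]
  have has := sq_sqrt ha.le
  have hs := sqrt_pos.2 ha
  have ht := sqrt_pos.2 hm
  have hlog : log (√m / √a) ≤ √m / √a - 1 := log_le_sub_one_of_pos (by positivity)
  rw [log_div ht.ne' hs.ne', log_sqrt hm.le, log_sqrt ha.le] at hlog
  have h := mul_le_mul_of_nonneg_left hlog ha.le
  have e : a * (√m / √a - 1) = √m * √a - a := by
    nth_rewrite 1 [← has]
    field_simp
    linear_combination -has
  rw [e] at h
  nlinarith

lemma neg_one_le_mul_log {t : ℝ} (ht : 0 ≤ t) : -1 ≤ t * log t := by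
  have h := sq_sqrt_sub_sqrt_le_mul_log_sub ht one_pos
  simp only [log_one, mul_zero, sub_zero] at h
  nlinarith [sq_nonneg (√t - √1)]

lemma mul_log_midpoint_le {a b : ℝ} (ha : 0 ≤ a) (hb : 0 ≤ b) :
    2 * ((a + b) / 2 * log ((a + b) / 2)) ≤ a * log a + b * log b := by
  have h := convexOn_mul_log.2 (Set.mem_Ici.2 ha) (Set.mem_Ici.2 hb)
    (by norm_num : (0 : ℝ) ≤ 1 / 2) (by norm_num : (0 : ℝ) ≤ 1 / 2) (by norm_num)
  simp only [smul_eq_mul] at h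
  rw [show 1 / 2 * a + 1 / 2 * b = (a + b) / 2 by ring] at h
  linarith

/-- Quantitative strict convexity of `t * log t` at midpoints. -/
lemma abs_sub_le_mul_log_midpoint_gap {a b ε : ℝ} (ha : 0 ≤ a) (hb : 0 ≤ b) (hε : 0 < ε) :
    |a - b| ≤ (a * log a + b * log b - 2 * ((a + b) / 2 * log ((a + b) / 2))) / (4 * ε)
      + 4 * ε * (a + b) := by
  rcases (add_nonneg ha hb).eq_or_lt with h0 | h0
  · obtain rfl : a = 0 := by linarith
    obtain rfl : b = 0 := by linarith
    simp
  set m := (a + b) / 2 with hm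
  have hm0 : 0 < m := by positivity
  have key : ∀ c, 0 ≤ c → |c - m| ≤ (√c - √m) ^ 2 / (4 * ε) + ε * (2 * (c + m)) := by
    intro c hc
    have h1 : |c - m| = |√c - √m| * (√c + √m) := by
      rw [← abs_of_nonneg (by positivity : 0 ≤ √c + √m), ← abs_mul]
      congr 1
      nlinarith [sq_sqrt hc, sq_sqrt hm0.le]
    have h2 : (√c + √m) ^ 2 ≤ 2 * (c + m) := by
      nlinarith [sq_sqrt hc, sq_sqrt hm0.le, sq_nonneg (√c - √m)]
    have h3 : |√c - √m| * (√c + √m) ≤ (√c - √m) ^ 2 / (4 * ε) + ε * (√c + √m) ^ 2 := by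
      have h4 : (√c - √m) ^ 2 / (4 * ε) + ε * (√c + √m) ^ 2 - |√c - √m| * (√c + √m)
          = (|√c - √m| - 2 * ε * (√c + √m)) ^ 2 / (4 * ε) := by
        rw [← sq_abs (√c - √m)]
        field_simp
        ring
      have h5 : 0 ≤ (|√c - √m| - 2 * ε * (√c + √m)) ^ 2 / (4 * ε) := by positivity
      linarith
    rw [h1]
    nlinarith
  have hab : |a - b| ≤ |a - m| + |b - m| := by
    rw [abs_sub_comm b m]
    exact abs_sub_le a m b
  have hgap : (√a - √m) ^ 2 + (√b - √m) ^ 2 ≤ a * log a + b * log b - 2 * (m * log m) := by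
    have h1 := sq_sqrt_sub_sqrt_le_mul_log_sub ha hm0
    have h2 := sq_sqrt_sub_sqrt_le_mul_log_sub hb hm0
    have h3 : a = 2 * m - b := by rw [hm]; ring
    have h4 : a * log m + b * log m = 2 * (m * log m) := by rw [h3]; ring
    linarith
  have hdiv : (√a - √m) ^ 2 / (4 * ε) + (√b - √m) ^ 2 / (4 * ε)
      ≤ (a * log a + b * log b - 2 * (m * log m)) / (4 * ε) := by
    rw [← add_div]
    gcongr
  have hsum : ε * (2 * (a + m)) + ε * (2 * (b + m)) = 4 * ε * (a + b) := by rw [hm]; ring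
  linarith [key a ha, key b hb]

section Midpoint

variable {α : Type*} [MeasurableSpace α] {μ : Measure α} {u v : α → ℝ}

lemma integrable_mul_log_midpoint [IsFiniteMeasure μ] (hum : Measurable u) (hvm : Measurable v)
    (hu0 : ∀ x, 0 ≤ u x) (hv0 : ∀ x, 0 ≤ v x)
    (hu : Integrable (fun x => u x * log (u x)) μ)
    (hv : Integrable (fun x => v x * log (v x)) μ) :
    Integrable (fun x => (u x + v x) / 2 * log ((u x + v x) / 2)) μ := by
  refine Integrable.mono' (((integrable_const (1 : ℝ)).add hu.abs).add hv.abs)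
    (by fun_prop) (Eventually.of_forall fun x => ?_)
  have h1 := neg_one_le_mul_log (t := (u x + v x) / 2) (by linarith [hu0 x, hv0 x])
  have h2 := mul_log_midpoint_le (hu0 x) (hv0 x)
  simp only [Pi.add_apply, norm_eq_abs]
  have h3 := le_abs_self (u x * log (u x))
  have h4 := le_abs_self (v x * log (v x))
  have h5 := abs_nonneg (u x * log (u x))
  have h6 := abs_nonneg (v x * log (v x))
  exact abs_le.2 ⟨by linarith, by linarith⟩

lemma integral_abs_sub_le_mul_log_midpoint_gap [IsFiniteMeasure μ]
    (hum : Measurable u) (hvm : Measurable v)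
    (hu0 : ∀ x, 0 ≤ u x) (hv0 : ∀ x, 0 ≤ v x) (hui : Integrable u μ) (hvi : Integrable v μ)
    (hu : Integrable (fun x => u x * log (u x)) μ)
    (hv : Integrable (fun x => v x * log (v x)) μ) {ε : ℝ} (hε : 0 < ε) :
    ∫ x, |u x - v x| ∂μ ≤ (∫ x, u x * log (u x) ∂μ + ∫ x, v x * log (v x) ∂μ
        - 2 * ∫ x, (u x + v x) / 2 * log ((u x + v x) / 2) ∂μ) / (4 * ε)
      + 4 * ε * (∫ x, u x ∂μ + ∫ x, v x ∂μ) := by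
  have hm := integrable_mul_log_midpoint hum hvm hu0 hv0 hu hv
  have hsum : Integrable (fun x => u x * log (u x) + v x * log (v x)) μ := hu.add hv
  have hgap := (hsum.sub (hm.const_mul 2)).div_const (4 * ε)
  have hadd := (hui.add hvi).const_mul (4 * ε)
  rw [← integral_add hu hv, ← integral_const_mul, ← integral_sub hsum (hm.const_mul 2),
    ← integral_div, ← integral_add hui hvi, ← integral_const_mul]
  exact (integral_mono (hui.sub hvi).abs (hgap.add hadd) fun x =>
    abs_sub_le_mul_log_midpoint_gap (hu0 x) (hv0 x) hε).trans_eq (integral_add hgap hadd)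

end Midpoint

/-- Completeness of `L¹`, for sequences of functions. -/
lemma exists_tendsto_integral_abs_sub_of_cauchy {α : Type*} [MeasurableSpace α] {μ : Measure α}
    {u : ℕ → α → ℝ} (hu : ∀ r, Integrable (u r) μ)
    (hC : ∀ ε > 0, ∃ N, ∀ r ≥ N, ∀ s ≥ N, ∫ x, |u r x - u s x| ∂μ < ε) :
    ∃ g : α → ℝ, Integrable g μ ∧ Tendsto (fun r => ∫ x, |u r x - g x| ∂μ) atTop (nhds 0) := by
  have hd : ∀ {a b : α → ℝ} (ha : Integrable a μ) (hb : Integrable b μ),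
      dist (ha.toL1 a) (hb.toL1 b) = ∫ x, |a x - b x| ∂μ := by
    intro a b ha hb
    rw [dist_eq_norm, ← Integrable.toL1_sub, L1.norm_of_fun_eq_integral_norm]
    rfl
  have hcs : CauchySeq fun r => (hu r).toL1 (u r) := by
    refine Metric.cauchySeq_iff.2 fun ε hε => ?_
    simpa only [hd] using hC ε hε
  obtain ⟨g, hg⟩ := cauchySeq_tendsto_of_complete hcs
  refine ⟨g, L1.integrable_coeFn g, ?_⟩
  rw [tendsto_iff_dist_tendsto_zero] at hg
  refine hg.congr fun r => ?_
  rw [← hd (hu r) (L1.integrable_coeFn g), Integrable.toL1_coeFn]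

section Moments

variable {n : ℕ} {K : Set (Fin n → ℝ)}

/-- Multivariate polynomials are uniformly dense in the continuous functions on a compact set. -/
lemma exists_mvPolynomial_near_of_isCompact (hK : IsCompact K) {g : (Fin n → ℝ) → ℝ}
    (hg : Continuous g) {ε : ℝ} (hε : 0 < ε) :
    ∃ P : MvPolynomial (Fin n) ℝ, ∀ x ∈ K, |MvPolynomial.eval x P - g x| < ε := by
  let coord : Fin n → C(Fin n → ℝ, ℝ) := fun i => ⟨fun x => x i, continuous_apply i⟩
  have heval : ∀ (P : MvPolynomial (Fin n) ℝ) (x : Fin n → ℝ),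
      MvPolynomial.aeval coord P x = MvPolynomial.eval x P := by
    intro P x
    induction P using MvPolynomial.induction_on with
    | C a => simp
    | add p q hp hq => simp [hp, hq]
    | mul_X p i hp => simp [hp, coord]
  have hsep : (MvPolynomial.aeval (R := ℝ) coord).range.SeparatesPoints := by
    intro x y hxy
    obtain ⟨i, hi⟩ := Function.ne_iff.1 hxy
    exact ⟨coord i, ⟨coord i, ⟨MvPolynomial.X i, by simp⟩, rfl⟩, hi⟩
  obtain ⟨_, ⟨P, rfl⟩, hP⟩ :=
    ContinuousMap.exists_mem_subalgebra_near_continuous_of_isCompact_of_separatesPoints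
      hsep ⟨g, hg⟩ hK hε
  refine ⟨P, fun x hx => ?_⟩
  rw [← heval]
  exact hP x hx

lemma integrableOn_continuous_mul (hK : IsCompact K)
    {g h : (Fin n → ℝ) → ℝ} (hg : Continuous g) (hh : IntegrableOn h K) :
    IntegrableOn (fun x => g x * h x) K :=
  hh.continuousOn_mul hg.continuousOn hK

/-- An integrable function on a compact set all of whose moments vanish is zero a.e. -/
lemma ae_eq_zero_of_moments_eq_zero (hK : IsCompact K) (hKm : MeasurableSet K)
    {h : (Fin n → ℝ) → ℝ} (hh : IntegrableOn h K)
    (hmom : ∀ α : Fin n → ℕ, ∫ x in K, (∏ i, x i ^ α i) * h x = 0) :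
    ∀ᵐ x ∂volume.restrict K, h x = 0 := by
  have hpoly : ∀ P : MvPolynomial (Fin n) ℝ, ∫ x in K, MvPolynomial.eval x P * h x = 0 := by
    intro P
    simp_rw [MvPolynomial.eval_eq', Finset.sum_mul, mul_assoc]
    rw [integral_finsetSum]
    · simp_rw [integral_const_mul, hmom, mul_zero, Finset.sum_const_zero]
    · exact fun d _ => (integrableOn_continuous_mul hK (by fun_prop) hh).const_mul _
  have hcont : ∀ g : (Fin n → ℝ) → ℝ, Continuous g → ∫ x in K, g x * h x = 0 := by
    intro g hg
    have hbound : ∀ ε > 0, |∫ x in K, g x * h x| ≤ ε * ∫ x in K, |h x| := by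
      intro ε hε
      obtain ⟨P, hP⟩ := exists_mvPolynomial_near_of_isCompact hK hg hε
      have hgi := integrableOn_continuous_mul hK hg hh
      have hPi := integrableOn_continuous_mul hK (MvPolynomial.continuous_eval P) hh
      have e : ∫ x in K, g x * h x = ∫ x in K, (g x * h x - MvPolynomial.eval x P * h x) := by
        rw [integral_sub hgi hPi, hpoly, sub_zero]
      rw [e, ← integral_const_mul]
      refine abs_integral_le_integral_abs.trans
        (setIntegral_mono_on (hgi.sub hPi).abs (hh.abs.const_mul ε) hKm fun x hx => ?_)
      rw [← sub_mul, abs_mul, abs_sub_comm]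
      exact mul_le_mul_of_nonneg_right (hP x hx).le (abs_nonneg _)
    have hlim : Tendsto (fun ε : ℝ => ε * ∫ x in K, |h x|) (nhdsWithin 0 (Set.Ioi 0)) (nhds 0) := by
      have : Tendsto (fun ε : ℝ => ε * ∫ x in K, |h x|) (nhds 0) (nhds (0 * ∫ x in K, |h x|)) :=
        tendsto_id.mul_const _
      rw [zero_mul] at this
      exact this.mono_left nhdsWithin_le_nhds
    exact abs_nonpos_iff.1 (ge_of_tendsto hlim (eventually_mem_nhdsWithin.mono hbound))
  have hind : ∀ᵐ x, K.indicator h x = 0 := by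
    refine ae_eq_zero_of_integral_contDiff_smul_eq_zero
      ((integrable_indicator_iff hKm).2 hh).locallyIntegrable fun g hg _ => ?_
    rw [← hcont g hg.continuous, ← integral_indicator hKm]
    congr 1 with x
    by_cases hx : x ∈ K <;> simp [hx]
  rw [ae_restrict_iff' hKm]
  filter_upwards [hind] with x hx hxK
  rwa [Set.indicator_of_mem hxK] at hx

/-- If `L¹` functions on a compact set have moments which eventually agree with those of `f`,
then their `L¹` limit is `f`. -/
lemma ae_eq_of_tendsto_of_moments_eq (hK : IsCompact K) (hKm : MeasurableSet K)
    {f g : (Fin n → ℝ) → ℝ} {u : ℕ → (Fin n → ℝ) → ℝ} (hf : IntegrableOn f K)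
    (hg : IntegrableOn g K) (hu : ∀ r, IntegrableOn (u r) K)
    (hmom : ∀ r, ∀ α : Fin n → ℕ, (∑ i, α i) ≤ r →
      (∫ x in K, (∏ i, x i ^ α i) * u r x) = ∫ x in K, (∏ i, x i ^ α i) * f x)
    (hlim : Tendsto (fun r => ∫ x in K, |u r x - g x|) atTop (nhds 0)) :
    f =ᵐ[volume.restrict K] g := by
  have hzero := ae_eq_zero_of_moments_eq_zero hK hKm (h := fun x => f x - g x) (hf.sub hg) ?_
  · filter_upwards [hzero] with x hx using sub_eq_zero.1 hx
  intro α
  set c : (Fin n → ℝ) → ℝ := fun x => ∏ i, x i ^ α i with hc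
  have hcc : Continuous c := by fun_prop
  obtain ⟨C, hC⟩ := hK.exists_bound_of_continuousOn hcc.continuousOn
  have hcf := integrableOn_continuous_mul hK hcc hf
  have hcg := integrableOn_continuous_mul hK hcc hg
  have hbound : ∀ᶠ r in atTop,
      |∫ x in K, c x * (f x - g x)| ≤ C * ∫ x in K, |u r x - g x| := by
    filter_upwards [eventually_ge_atTop (∑ i, α i)] with r hr
    have hcu := integrableOn_continuous_mul hK hcc (hu r)
    have e : ∫ x in K, c x * (f x - g x) = ∫ x in K, c x * (u r x - g x) := by
      simp_rw [mul_sub]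
      rw [integral_sub hcf hcg, integral_sub hcu hcg, hmom r α hr]
    rw [e, ← integral_const_mul]
    refine abs_integral_le_integral_abs.trans
      (setIntegral_mono_on (integrableOn_continuous_mul hK hcc ((hu r).sub hg)).abs
        (((hu r).sub hg).abs.const_mul C) hKm fun x hx => ?_)
    rw [abs_mul]
    exact mul_le_mul_of_nonneg_right (hC x hx) (abs_nonneg _)
  have hC0 := hlim.const_mul C
  rw [mul_zero] at hC0
  exact abs_nonpos_iff.1 (ge_of_tendsto hC0 hbound)

end Moments

section Density

variable {n : ℕ} {K : Set (Fin n → ℝ)} {u v : (Fin n → ℝ) → ℝ}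

lemma IsDensityOn.integrableOn (hu : IsDensityOn K u) : IntegrableOn u K :=
  Integrable.of_integral_ne_zero (by rw [hu.2.2.2]; exact one_ne_zero)

lemma IsDensityOn.midpoint (hu : IsDensityOn K u) (hv : IsDensityOn K v) :
    IsDensityOn K (fun x => (u x + v x) / 2) := by
  refine ⟨(hu.1.add hv.1).div_const 2, fun x => by linarith [hu.2.1 x, hv.2.1 x],
    fun x hx => by simp [hu.2.2.1 x hx, hv.2.2.1 x hx], ?_⟩
  rw [integral_div, integral_add hu.integrableOn hv.integrableOn, hu.2.2.2, hv.2.2.2]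
  norm_num

end Density

/-- **Asymptotic approximation by Moment-Constrained Max-Entropy Distributions
(after Borwein–Lewis).** Let `K ⊆ ℝⁿ` be compact, measurable and of positive Lebesgue
measure, and let `f` be a probability density on `K` with integrable entropy
integrand. If for each `r` the density `p_r` matches all moments of `f` of total
degree at most `r` and maximizes the entropy `H(q) = -∫_K q ln q` among all such
densities, then `p_r → f` in `L¹`-norm: `∫_K |p_r − f| dx → 0` as `r → ∞`. -/
theorem maxEntropy_L1_convergence {n : ℕ} (K : Set (Fin n → ℝ))
    (hKc : IsCompact K) (hKm : MeasurableSet K) (hKpos : 0 < volume K)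
    (f : (Fin n → ℝ) → ℝ) (hf : IsDensityOn K f)
    (hfEnt : IntegrableOn (fun x => f x * Real.log (f x)) K volume)
    (p : ℕ → (Fin n → ℝ) → ℝ)
    (hpDens : ∀ r, IsDensityOn K (p r))
    (hpEnt : ∀ r, IntegrableOn (fun x => p r x * Real.log (p r x)) K volume)
    (hpMom : ∀ r, ∀ α : Fin n → ℕ, (∑ i, α i) ≤ r →
      (∫ x in K, (∏ i, x i ^ α i) * p r x) = ∫ x in K, (∏ i, x i ^ α i) * f x)
    (hpMax : ∀ r, ∀ q : (Fin n → ℝ) → ℝ, IsDensityOn K q →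
      IntegrableOn (fun x => q x * Real.log (q x)) K volume →
      (∀ α : Fin n → ℕ, (∑ i, α i) ≤ r →
        (∫ x in K, (∏ i, x i ^ α i) * q x) = ∫ x in K, (∏ i, x i ^ α i) * f x) →
      (-∫ x in K, q x * Real.log (q x)) ≤ (-∫ x in K, p r x * Real.log (p r x))) :
    Tendsto (fun r => ∫ x in K, |p r x - f x|) atTop (nhds 0) := by
  have : IsFiniteMeasure (volume.restrict K) := ⟨by simpa using hKc.measure_lt_top⟩
  have hpi r := (hpDens r).integrableOn
  set E : ℕ → ℝ := fun r => ∫ x in K, p r x * Real.log (p r x) with hE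
  have hmono : Monotone E := fun r s hrs =>
    neg_le_neg_iff.1 (hpMax r (p s) (hpDens s) (hpEnt s) fun α hα => hpMom s α (hα.trans hrs))
  have hbdd : BddAbove (Set.range E) := by
    refine ⟨∫ x in K, f x * Real.log (f x), ?_⟩
    rintro _ ⟨r, rfl⟩
    exact neg_le_neg_iff.1 (hpMax r f hf hfEnt fun _ _ => rfl)
  have hgap : ∀ r s, r ≤ s → ∀ ε > 0, ∫ x in K, |p r x - p s x| ≤
      (E s - E r) / (4 * ε) + 8 * ε := by
    intro r s hrs ε hε
    have h := integral_abs_sub_le_mul_log_midpoint_gap (hpDens r).1 (hpDens s).1 (hpDens r).2.1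
      (hpDens s).2.1 (hpi r) (hpi s) (hpEnt r) (hpEnt s) hε
    have hmid := hpMax r _ ((hpDens r).midpoint (hpDens s))
      (integrable_mul_log_midpoint (hpDens r).1 (hpDens s).1 (hpDens r).2.1
        (hpDens s).2.1 (hpEnt r) (hpEnt s)) ?_
    · rw [(hpDens r).2.2.2, (hpDens s).2.2.2] at h
      have hle : (∫ x in K, p r x * Real.log (p r x)) + (∫ x in K, p s x * Real.log (p s x))
          - 2 * (∫ x in K, (p r x + p s x) / 2 * Real.log ((p r x + p s x) / 2))
          ≤ E s - E r := by
        simp only [hE]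
        linarith
      refine h.trans (add_le_add (div_le_div_of_nonneg_right hle (by positivity)) ?_)
      linarith
    · intro α hα
      have hc : Continuous fun x : Fin n → ℝ => ∏ i, x i ^ α i := by fun_prop
      simp_rw [← mul_div_assoc, mul_add]
      rw [integral_div, integral_add (integrableOn_continuous_mul hKc hc (hpi r))
        (integrableOn_continuous_mul hKc hc (hpi s)), hpMom r α hα,
        hpMom s α (hα.trans hrs), add_self_div_two]
  have hcauchy : ∀ ε > 0, ∃ N, ∀ r ≥ N, ∀ s ≥ N, ∫ x in K, |p r x - p s x| < ε := by
    intro ε hε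
    obtain ⟨N, hN⟩ := Metric.cauchySeq_iff.1 (tendsto_atTop_ciSup hmono hbdd).cauchySeq
      (ε ^ 2 / 8) (by positivity)
    have hordered : ∀ r ≥ N, ∀ s ≥ r, ∫ x in K, |p r x - p s x| < ε := by
      intro r hr s hs
      have hEs : E s - E r < ε ^ 2 / 8 :=
        (le_abs_self _).trans_lt (hN s (hr.trans hs) r hr)
      have h := hgap r s hs (ε / 16) (by positivity)
      have h2 : (E s - E r) / (4 * (ε / 16)) < ε / 2 := by
        rw [div_lt_iff₀ (by positivity)]
        linarith
      linarith
    refine ⟨N, fun r hr s hs => ?_⟩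
    rcases le_total r s with h | h
    · exact hordered r hr s h
    · simpa only [abs_sub_comm] using hordered s hs r h
  obtain ⟨g, hg, hlim⟩ := exists_tendsto_integral_abs_sub_of_cauchy hpi hcauchy
  have hfg := ae_eq_of_tendsto_of_moments_eq hKc hKm hf.integrableOn hg hpi hpMom hlim
  refine hlim.congr fun r => integral_congr_ae ?_
  filter_upwards [hfg] with x hx
  rw [hx]
end
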